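/- arXiv:2007.00574 — 3 statements merged into one kernel-verified Lean document; each statement's English description precedes it below -/
import Mathlib

section
/- Let m, λ, γ > 0 and for n ≥ 1 let f_n(r) = (n²λ/(2π r³))^{1/2} exp(−n²λ(r − nm)²/(2 n² m² r)) for r > 0 be the density of the inverse Gaussian distribution IG(nm, n²λ). Then as n → ∞, ∫_{(0,∞)} r^{−γ} f_n(r) dr = m^{−γ} n^{−γ} (1 + O(n^{−1})); i.e. there exist K and N such that for all n ≥ N, |∫_{(0,∞)} r^{−γ} f_n(r) dr − m^{−γ} n^{−γ}| ≤ K n^{−γ−1}. -/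
open MeasureTheory Filter Topology

/-- Symmetrisation of `exp (-p * arsinh v)` yields `2 * cosh (p * arsinh v)`. -/
lemma exp_arsinh_add_neg (p v : ℝ) :
    Real.exp (-p * Real.arsinh v) + Real.exp (-p * Real.arsinh (-v))
      = 2 * Real.cosh (p * Real.arsinh v) := by
  rw [Real.cosh_eq, Real.arsinh_neg]
  ring_nf

lemma abs_arsinh_le (v : ℝ) : |Real.arsinh v| ≤ |v| := by
  rcases le_total 0 v with h | h
  · have h0 : 0 ≤ Real.arsinh v := Real.arsinh_nonneg_iff.2 h
    have h1 := Real.self_le_sinh_iff.2 h0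
    rw [Real.sinh_arsinh] at h1
    rwa [abs_of_nonneg h0, abs_of_nonneg h]
  · have h0 : Real.arsinh v ≤ 0 := Real.arsinh_nonpos_iff.2 h
    have h1 := Real.sinh_le_self_iff.2 h0
    rw [Real.sinh_arsinh] at h1
    rw [abs_of_nonpos h0, abs_of_nonpos h]
    linarith

lemma cosh_mul_arsinh_le (p v : ℝ) :
    Real.cosh (p * Real.arsinh v) ≤ Real.exp (p ^ 2 / 2 * v ^ 2) := by
  refine (Real.cosh_le_exp_half_sq _).trans (Real.exp_le_exp.2 ?_)
  have h := sq_le_sq.2 (abs_arsinh_le v)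
  nlinarith [mul_le_mul_of_nonneg_left h (sq_nonneg p)]

lemma sqrt_le_cosh_mul_arsinh {p : ℝ} (hp : 1 ≤ p) (v : ℝ) :
    √(1 + v ^ 2) ≤ Real.cosh (p * Real.arsinh v) := by
  rw [← Real.cosh_arsinh, Real.cosh_le_cosh, abs_mul]
  exact le_mul_of_one_le_left (abs_nonneg _) (hp.trans (le_abs_self p))

lemma one_le_sqrt_one_add_sq (v : ℝ) : 1 ≤ √(1 + v ^ 2) :=
  Real.one_le_sqrt.2 (by nlinarith [sq_nonneg v])

lemma integrable_exp_arsinh_mul_gaussian {p b : ℝ} (hb : p ^ 2 / 2 < b) :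
    Integrable fun v : ℝ =>
      Real.exp (-p * Real.arsinh v) / √(1 + v ^ 2) * Real.exp (-b * v ^ 2) := by
  have hdom := (integrable_exp_neg_mul_sq (sub_pos.2 hb)).const_mul 2
  refine hdom.mono' ?_ (ae_of_all _ fun v => ?_)
  · refine Continuous.aestronglyMeasurable ?_
    have hs : ∀ v : ℝ, √(1 + v ^ 2) ≠ 0 := fun v => by positivity
    have ha : Continuous Real.arsinh := Real.continuous_arsinh
    fun_prop (disch := exact hs _)
  · rw [Real.norm_of_nonneg (by positivity)]
    have h1 : Real.exp (-p * Real.arsinh v) ≤ 2 * Real.exp (p ^ 2 / 2 * v ^ 2) := by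
      linarith [exp_arsinh_add_neg p v, cosh_mul_arsinh_le p v,
        Real.exp_pos (-p * Real.arsinh (-v))]
    have h2 : Real.exp (-p * Real.arsinh v) / √(1 + v ^ 2) ≤ 2 * Real.exp (p ^ 2 / 2 * v ^ 2) :=
      (div_le_self (Real.exp_pos _).le (one_le_sqrt_one_add_sq v)).trans h1
    calc _ ≤ 2 * Real.exp (p ^ 2 / 2 * v ^ 2) * Real.exp (-b * v ^ 2) := by gcongr
      _ = 2 * Real.exp (-(b - p ^ 2 / 2) * v ^ 2) := by
        rw [mul_assoc, ← Real.exp_add]; ring_nf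

lemma integral_exp_arsinh_mul_gaussian {p b : ℝ} (hb : p ^ 2 / 2 < b) :
    Integrable (fun v : ℝ => Real.cosh (p * Real.arsinh v) / √(1 + v ^ 2)
        * Real.exp (-b * v ^ 2)) ∧
    ∫ v : ℝ, Real.exp (-p * Real.arsinh v) / √(1 + v ^ 2) * Real.exp (-b * v ^ 2)
      = ∫ v : ℝ, Real.cosh (p * Real.arsinh v) / √(1 + v ^ 2) * Real.exp (-b * v ^ 2) := by
  set f : ℝ → ℝ := fun v =>
    Real.exp (-p * Real.arsinh v) / √(1 + v ^ 2) * Real.exp (-b * v ^ 2) with hf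
  have hi : Integrable f := integrable_exp_arsinh_mul_gaussian hb
  have hi' : Integrable fun v => f (-v) := hi.comp_neg
  have he : (fun v : ℝ => Real.cosh (p * Real.arsinh v) / √(1 + v ^ 2) * Real.exp (-b * v ^ 2))
      = fun v => 1 / 2 * (f v + f (-v)) := by
    funext v
    have h := exp_arsinh_add_neg p v
    have h2 : Real.cosh (p * Real.arsinh v) = 1 / 2 *
      (Real.exp (-p * Real.arsinh v) + Real.exp (-p * Real.arsinh (-v))) := by linarith
    simp only [hf, h2, neg_sq]
    ring
  rw [he]
  refine ⟨(hi.add hi').const_mul _, ?_⟩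
  rw [integral_const_mul, integral_add hi hi', integral_neg_eq_self f volume]
  ring

lemma sqrt_le_integral_exp_arsinh_mul_gaussian {p b : ℝ} (hp : 1 ≤ p) (hb : p ^ 2 / 2 < b) :
    √(Real.pi / b) ≤
      ∫ v : ℝ, Real.exp (-p * Real.arsinh v) / √(1 + v ^ 2) * Real.exp (-b * v ^ 2) := by
  obtain ⟨hi, he⟩ := integral_exp_arsinh_mul_gaussian hb
  rw [he, ← integral_gaussian]
  refine integral_mono (integrable_exp_neg_mul_sq (by nlinarith)) hi fun v => ?_
  refine le_mul_of_one_le_left (Real.exp_pos _).le ?_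
  rw [one_le_div (by positivity)]
  exact sqrt_le_cosh_mul_arsinh hp v

lemma integral_exp_arsinh_mul_gaussian_le {p b : ℝ} (hb : p ^ 2 / 2 < b) :
    ∫ v : ℝ, Real.exp (-p * Real.arsinh v) / √(1 + v ^ 2) * Real.exp (-b * v ^ 2)
      ≤ √(Real.pi / (b - p ^ 2 / 2)) := by
  obtain ⟨hi, he⟩ := integral_exp_arsinh_mul_gaussian hb
  rw [he, ← integral_gaussian]
  refine integral_mono hi (integrable_exp_neg_mul_sq (sub_pos.2 hb)) fun v => ?_
  have h : Real.cosh (p * Real.arsinh v) / √(1 + v ^ 2) ≤ Real.exp (p ^ 2 / 2 * v ^ 2) :=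
    (div_le_self (Real.cosh_pos _).le (one_le_sqrt_one_add_sq v)).trans (cosh_mul_arsinh_le p v)
  calc _ ≤ Real.exp (p ^ 2 / 2 * v ^ 2) * Real.exp (-b * v ^ 2) := by gcongr
    _ = Real.exp (-(b - p ^ 2 / 2) * v ^ 2) := by rw [← Real.exp_add]; ring_nf

/-- The substitution `r = c * exp (2 * arsinh v)` on the positive half-line. -/
lemma integral_Ioi_comp_mul_exp_two_mul_arsinh {c : ℝ} (hc : 0 < c) (g : ℝ → ℝ) :
    ∫ r in Set.Ioi (0 : ℝ), g r
      = ∫ v : ℝ, c * Real.exp (2 * Real.arsinh v) * (2 / √(1 + v ^ 2))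
          * g (c * Real.exp (2 * Real.arsinh v)) := by
  have himg : (fun v : ℝ => c * Real.exp (2 * Real.arsinh v)) '' Set.univ = Set.Ioi 0 := by
    ext r
    simp only [Set.image_univ, Set.mem_range, Set.mem_Ioi]
    constructor
    · rintro ⟨v, rfl⟩
      positivity
    · intro hr
      refine ⟨Real.sinh (Real.log (r / c) / 2), ?_⟩
      rw [Real.arsinh_sinh, mul_div_cancel₀ _ two_ne_zero, Real.exp_log (div_pos hr hc),
        mul_div_cancel₀ _ hc.ne']
  have hinj : Set.InjOn (fun v : ℝ => c * Real.exp (2 * Real.arsinh v)) Set.univ := by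
    intro v _ w _ h
    exact Real.arsinh_injective
      (mul_left_cancel₀ two_ne_zero (Real.exp_injective (mul_left_cancel₀ hc.ne' h)))
  have hderiv : ∀ v ∈ Set.univ, HasDerivWithinAt
      (fun v : ℝ => c * Real.exp (2 * Real.arsinh v))
      (c * Real.exp (2 * Real.arsinh v) * (2 / √(1 + v ^ 2))) Set.univ v := by
    intro v _
    refine HasDerivAt.hasDerivWithinAt ?_
    refine ((((Real.hasDerivAt_arsinh v).const_mul 2).exp).const_mul c).congr_deriv ?_
    ring
  have h := integral_image_eq_integral_abs_deriv_smul MeasurableSet.univ hderiv hinj g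
  rw [himg, Measure.restrict_univ] at h
  rw [h]
  refine integral_congr_ae (ae_of_all _ fun v => ?_)
  simp only [smul_eq_mul]
  rw [abs_of_pos (by positivity)]

/-- The moment of order `-γ` of an inverse Gaussian law with mean `c` and shape `s`, as an
integral against a Gaussian weight. -/
lemma integral_rpow_mul_inverseGaussian {c s γ : ℝ} (hc : 0 < c) (hs : 0 < s) :
    ∫ r in Set.Ioi (0 : ℝ), r ^ (-γ) * (√(s / (2 * Real.pi * r ^ 3))
        * Real.exp (-(s * (r - c) ^ 2) / (2 * c ^ 2 * r)))
      = c ^ (-γ) * √(2 * s / c / Real.pi) *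
        ∫ v : ℝ, Real.exp (-(2 * γ + 1) * Real.arsinh v) / √(1 + v ^ 2)
          * Real.exp (-(2 * s / c) * v ^ 2) := by
  rw [integral_Ioi_comp_mul_exp_two_mul_arsinh hc, ← integral_const_mul]
  refine integral_congr_ae (ae_of_all _ fun v => ?_)
  simp only
  set a := Real.arsinh v with ha
  have hv : v = (Real.exp a - (Real.exp a)⁻¹) / 2 := by
    rw [← Real.exp_neg, ← Real.sinh_eq, ha, Real.sinh_arsinh]
  have hE : Real.exp (2 * a) = Real.exp a ^ 2 := by
    rw [two_mul, Real.exp_add, sq]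
  have hpow : (c * Real.exp (2 * a)) ^ (-γ) = c ^ (-γ) * Real.exp (-(2 * γ) * a) := by
    rw [Real.mul_rpow hc.le (Real.exp_pos _).le, ← Real.exp_mul]
    ring_nf
  have hexp : -(s * (c * Real.exp (2 * a) - c) ^ 2) / (2 * c ^ 2 * (c * Real.exp (2 * a)))
      = -(2 * s / c) * v ^ 2 := by
    rw [hE, hv]
    have := (Real.exp_pos a).ne'
    field_simp
  have hsqrt : √(s / (2 * Real.pi * (c * Real.exp (2 * a)) ^ 3))
      = √(2 * s / c / Real.pi) * (1 / (2 * c * Real.exp a ^ 3)) := by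
    rw [← Real.sqrt_sq (show 0 ≤ 1 / (2 * c * Real.exp a ^ 3) by positivity),
      ← Real.sqrt_mul (by positivity), hE]
    congr 1
    have := (Real.exp_pos a).ne'
    field_simp
  have hsplit : Real.exp (-(2 * γ + 1) * a) = Real.exp (-(2 * γ) * a) * (Real.exp a)⁻¹ := by
    rw [← Real.exp_neg, ← Real.exp_add]
    ring_nf
  rw [hpow, hexp, hsqrt, hsplit, hE]
  have := (Real.exp_pos a).ne'
  have h1 : √(1 + v ^ 2) ≠ 0 := by positivity
  field_simp

/-- Quantitative convergence of the normalised integral to `1`. -/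
lemma abs_sqrt_mul_integral_sub_one_le {p b : ℝ} (hp : 1 ≤ p) (hb : p ^ 2 ≤ b) :
    |√(b / Real.pi) * (∫ v : ℝ, Real.exp (-p * Real.arsinh v) / √(1 + v ^ 2)
        * Real.exp (-b * v ^ 2)) - 1| ≤ p ^ 2 / b := by
  have hp2 : 0 < p ^ 2 := by positivity
  have hb0 : 0 < b := hp2.trans_le hb
  have hb2 : p ^ 2 / 2 < b := by linarith
  have hd : 0 < b - p ^ 2 / 2 := sub_pos.2 hb2
  have hlow := mul_le_mul_of_nonneg_left (sqrt_le_integral_exp_arsinh_mul_gaussian hp hb2)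
    (Real.sqrt_nonneg (b / Real.pi))
  have hup := mul_le_mul_of_nonneg_left (integral_exp_arsinh_mul_gaussian_le hb2)
    (Real.sqrt_nonneg (b / Real.pi))
  have hπ := Real.pi_pos
  rw [← Real.sqrt_mul (by positivity)] at hlow hup
  have e1 : b / Real.pi * (Real.pi / b) = 1 := by field_simp
  have e2 : √(b / Real.pi * (Real.pi / (b - p ^ 2 / 2))) ≤ 1 + p ^ 2 / b := by
    have h1 : 0 ≤ p ^ 2 / b := by positivity
    refine Real.sqrt_le_iff.2 ⟨by positivity, ?_⟩
    have h2 : b / Real.pi * (Real.pi / (b - p ^ 2 / 2)) ≤ 1 + p ^ 2 / b := by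
      have : b / Real.pi * (Real.pi / (b - p ^ 2 / 2)) = b / (b - p ^ 2 / 2) := by field_simp
      rw [this, div_le_iff₀ hd]
      have h3 : (1 + p ^ 2 / b) * (b - p ^ 2 / 2) = b + p ^ 2 / 2 * (1 - p ^ 2 / b) := by
        field_simp
        ring
      have h4 : p ^ 2 / b ≤ 1 := (div_le_one hb0).2 hb
      rw [h3]
      nlinarith
    nlinarith
  rw [e1, Real.sqrt_one] at hlow
  rw [abs_of_nonneg (by linarith)]
  linarith

/-- Let `f_n` be the density of the inverse Gaussian distribution
`IG(nm, n²λ)`. Then, as `n → ∞`,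
`∫_{(0,∞)} r^{−γ} f_n(r) dr = m^{−γ} n^{−γ} (1 + O(n^{−1}))`, i.e. there are `K`, `N`
such that `|∫_{(0,∞)} r^{−γ} f_n(r) dr − m^{−γ} n^{−γ}| ≤ K n^{−γ−1}` for all `n ≥ N`. -/
theorem stmt12 (m lam γ : ℝ) (hm : 0 < m) (hlam : 0 < lam) (hγ : 0 < γ) :
    ∃ (K : ℝ) (N : ℕ), ∀ n : ℕ, N ≤ n →
      |(∫ r in Set.Ioi (0 : ℝ),
          r ^ (-γ) * (Real.sqrt ((n : ℝ) ^ 2 * lam / (2 * Real.pi * r ^ 3))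
            * Real.exp (-((n : ℝ) ^ 2 * lam * (r - n * m) ^ 2)
                / (2 * (n : ℝ) ^ 2 * m ^ 2 * r))))
          - m ^ (-γ) * (n : ℝ) ^ (-γ)|
        ≤ K * (n : ℝ) ^ (-γ - 1) := by
  set p := 2 * γ + 1 with hp
  obtain ⟨N, hN⟩ := exists_nat_ge (p ^ 2 * m / (2 * lam))
  refine ⟨m ^ (-γ) * (p ^ 2 * m / (2 * lam)), max N 1, fun n hn => ?_⟩
  have hn0 : (0 : ℝ) < n := Nat.cast_pos.2 ((le_max_right N 1).trans hn)
  have hnN : p ^ 2 * m / (2 * lam) ≤ n := hN.trans (Nat.cast_le.2 ((le_max_left N 1).trans hn))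
  have hb : 2 * ((n : ℝ) ^ 2 * lam) / (n * m) = 2 * n * lam / m := by field_simp
  have hpb : p ^ 2 ≤ 2 * n * lam / m := by
    rw [div_le_iff₀ (by positivity)] at hnN
    rw [le_div_iff₀ hm]
    linarith
  have hmain := abs_sqrt_mul_integral_sub_one_le (by linarith : 1 ≤ p) hpb
  have hint := integral_rpow_mul_inverseGaussian (γ := γ) (mul_pos hn0 hm)
    (by positivity : 0 < (n : ℝ) ^ 2 * lam)
  rw [hb, mul_pow] at hint
  simp only [← mul_assoc (2 : ℝ) ((n : ℝ) ^ 2)] at hint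
  rw [hint, ← hp, Real.mul_rpow hn0.le hm.le, mul_comm (m ^ (-γ)) ((n : ℝ) ^ (-γ)), mul_assoc,
    ← mul_sub_one, abs_mul, abs_of_pos (by positivity)]
  calc _ ≤ (n : ℝ) ^ (-γ) * m ^ (-γ) * (p ^ 2 / (2 * n * lam / m)) := by gcongr
    _ = _ := by
      rw [Real.rpow_sub_one hn0.ne']
      field_simp
end

section
/- Let 0 < p ≤ 1 and γ > 0. Then as n → ∞, (1−p)^n + Σ_{j=1}^{n} j^{−γ} C(n,j) p^j (1−p)^{n−j} = (np)^{−γ} + O(n^{−γ−1}); i.e. there exist K and N such that for all n ≥ N, |(1−p)^n + Σ_{j=1}^{n} j^{−γ} C(n,j) p^j (1−p)^{n−j} − (np)^{−γ}| ≤ K n^{−γ−1}. Equivalently, if μ is the Bernoulli(p) distribution on {0,1} and ε(r) = C(1 ∧ r^{−γ}), then ∫ ε(r) μ^{*n}(dr) = C(np)^{−γ} + O(n^{−γ−1}). -/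
open Filter Topology

/-- Bernoulli's inequality for a nonpositive real exponent. -/
theorem one_sub_mul_le_rpow_neg {s u : ℝ} (hs : 0 ≤ s) (hu : 0 < u) :
    1 - s * (u - 1) ≤ u ^ (-s) := by
  rw [Real.rpow_def_of_pos hu]
  nlinarith [Real.add_one_le_exp (Real.log u * -s), Real.log_le_sub_one_of_pos hu]

/-- The graph of `u ↦ u ^ (-s)` at `1` lies above its tangent line at `u`. -/
theorem rpow_neg_sub_one_le {s u : ℝ} (hs : 0 ≤ s) (hu : 0 < u) :
    u ^ (-s) - 1 ≤ s * u ^ (-(s + 1)) * (1 - u) := by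
  have h := one_sub_mul_le_rpow_neg hs (inv_pos.2 hu)
  rw [Real.inv_rpow hu.le, ← Real.rpow_neg hu.le, neg_neg] at h
  have h1 : u ^ (-s) * u ^ s = 1 := by rw [← Real.rpow_add hu]; simp
  have h2 : u ^ (-(s + 1)) = u ^ (-s) * u⁻¹ := by
    rw [neg_add, Real.rpow_add hu, Real.rpow_neg_one]
  have h3 := mul_le_mul_of_nonneg_left h (Real.rpow_pos_of_pos hu (-s)).le
  rw [h1] at h3
  have h4 : u⁻¹ * u = 1 := inv_mul_cancel₀ hu.ne'
  rw [h2]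
  linear_combination h3 + s * u ^ (-s) * h4

/-- Second-order Taylor bound for `u ↦ u ^ (-s)` at `1`, uniform on `[1/2, ∞)`. -/
theorem abs_rpow_neg_taylor_le {s u : ℝ} (hs : 0 ≤ s) (hu : 1 / 2 ≤ u) :
    |u ^ (-s) - 1 + s * (u - 1)| ≤ s * (s + 1) * 2 ^ (s + 2) * (u - 1) ^ 2 := by
  have hu0 : 0 < u := by linarith
  have hlow := one_sub_mul_le_rpow_neg hs hu0
  rw [abs_of_nonneg (by linarith)]
  have hup := rpow_neg_sub_one_le hs hu0
  suffices h : (u ^ (-(s + 1)) - 1) * (1 - u) ≤ (s + 1) * 2 ^ (s + 2) * (u - 1) ^ 2 by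
    nlinarith [mul_le_mul_of_nonneg_left h hs]
  have hs1 : 0 ≤ s + 1 := by linarith
  rcases le_total u 1 with h1 | h1
  · have h2 := rpow_neg_sub_one_le hs1 hu0
    have h3 : u ^ (-(s + 1 + 1)) ≤ 2 ^ (s + 2) := by
      rw [show s + 1 + 1 = s + 2 by ring, Real.rpow_neg hu0.le, ← Real.inv_rpow hu0.le]
      refine Real.rpow_le_rpow (by positivity) ?_ (by linarith)
      rw [inv_le_comm₀ hu0 two_pos]
      linarith
    calc (u ^ (-(s + 1)) - 1) * (1 - u)
        ≤ ((s + 1) * u ^ (-(s + 1 + 1)) * (1 - u)) * (1 - u) :=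
          mul_le_mul_of_nonneg_right h2 (by linarith)
      _ = (s + 1) * u ^ (-(s + 1 + 1)) * (u - 1) ^ 2 := by ring
      _ ≤ _ := by gcongr
  · have h2 := one_sub_mul_le_rpow_neg hs1 hu0
    have h3 : (1 : ℝ) ≤ 2 ^ (s + 2) := Real.one_le_rpow (by norm_num) (by linarith)
    calc (u ^ (-(s + 1)) - 1) * (1 - u) ≤ (s + 1) * 1 * (u - 1) ^ 2 := by nlinarith
      _ ≤ _ := by gcongr

/-- Taylor bound for `y ↦ (max y 1) ^ (-s)` at `x ≥ 2`, valid on all of `[0, ∞)` at the cost of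
an exponential term that controls the region `y < x / 2`. -/
theorem abs_max_rpow_neg_taylor_le {s x y : ℝ} (hs : 0 ≤ s) (hx : 2 ≤ x) (hy : 0 ≤ y) :
    |(max y 1) ^ (-s) - x ^ (-s) + s * x ^ (-s - 1) * (y - x)| ≤
      s * (s + 1) * 2 ^ (s + 2) * x ^ (-s - 2) * (y - x) ^ 2
        + (1 + s) * Real.exp (x / 2 - y) := by
  have hx0 : 0 < x := by linarith
  have hpow1 : x ^ (-s - 1) = x ^ (-s) / x := Real.rpow_sub_one hx0.ne' _
  have hpow2 : x ^ (-s - 2) = x ^ (-s) / x ^ 2 := by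
    exact_mod_cast Real.rpow_sub_natCast hx0.ne' (-s) 2
  have hxs : 0 < x ^ (-s) := Real.rpow_pos_of_pos hx0 _
  rw [hpow1, hpow2]
  rcases le_total (x / 2) y with h | h
  · have hu : 1 / 2 ≤ y / x := by rw [le_div_iff₀ hx0]; linarith
    have hy0 : 0 < y := by linarith
    have key := mul_le_mul_of_nonneg_left (abs_rpow_neg_taylor_le hs hu) hxs.le
    rw [← abs_of_pos hxs, ← abs_mul, abs_of_pos hxs] at key
    have hmul : x ^ (-s) * (y / x) ^ (-s) = y ^ (-s) := by
      rw [← Real.mul_rpow hx0.le (by positivity), mul_div_cancel₀ _ hx0.ne']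
    rw [max_eq_left (by linarith)]
    have e1 : y ^ (-s) - x ^ (-s) + s * (x ^ (-s) / x) * (y - x)
        = x ^ (-s) * ((y / x) ^ (-s) - 1 + s * (y / x - 1)) := by
      rw [← hmul]; field_simp
    have e2 : s * (s + 1) * 2 ^ (s + 2) * (x ^ (-s) / x ^ 2) * (y - x) ^ 2
        = x ^ (-s) * (s * (s + 1) * 2 ^ (s + 2) * (y / x - 1) ^ 2) := by
      field_simp
    rw [e1, e2]
    have : 0 ≤ (1 + s) * Real.exp (x / 2 - y) := by positivity
    linarith
  · have h1 : (max y 1) ^ (-s) ≤ 1 :=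
      Real.rpow_le_one_of_one_le_of_nonpos (le_max_right _ _) (by linarith)
    have h2 : 0 ≤ (max y 1) ^ (-s) := by positivity
    have h3 : x ^ (-s) ≤ 1 := Real.rpow_le_one_of_one_le_of_nonpos (by linarith) (by linarith)
    have h4 : s * (x ^ (-s) / x) * (y - x) = -(s * (x ^ (-s) * ((x - y) / x))) := by
      field_simp; ring
    have h5 : (x - y) / x ≤ 1 := by rw [div_le_one hx0]; linarith
    have h6 : 0 ≤ (x - y) / x := div_nonneg (by linarith) hx0.le
    have h7 : s * (x ^ (-s) * ((x - y) / x)) ≤ s * 1 :=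
      mul_le_mul_of_nonneg_left (mul_le_one₀ h3 h6 h5) hs
    have h8 : 0 ≤ s * (x ^ (-s) * ((x - y) / x)) := by positivity
    have h9 : 1 + s ≤ (1 + s) * Real.exp (x / 2 - y) :=
      le_mul_of_one_le_right (by linarith) (Real.one_le_exp (by linarith))
    have h10 : 0 ≤ s * (s + 1) * 2 ^ (s + 2) * (x ^ (-s) / x ^ 2) * (y - x) ^ 2 := by positivity
    rw [h4, abs_le]
    constructor <;> linarith

/-- The probability that a `Bin(n, p)` variable equals `j`. -/
noncomputable def binomialWeight (p : ℝ) (n j : ℕ) : ℝ :=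
  n.choose j * p ^ j * (1 - p) ^ (n - j)

theorem binomialWeight_nonneg {p : ℝ} (hp0 : 0 ≤ p) (hp1 : p ≤ 1) (n j : ℕ) :
    0 ≤ binomialWeight p n j := by
  have : 0 ≤ 1 - p := by linarith
  unfold binomialWeight
  positivity

theorem eval_bernsteinPolynomial_eq_binomialWeight (p : ℝ) (n j : ℕ) :
    (bernsteinPolynomial ℝ n j).eval p = binomialWeight p n j := by
  simp [bernsteinPolynomial, binomialWeight]

theorem sum_binomialWeight (p : ℝ) (n : ℕ) :
    ∑ j ∈ Finset.range (n + 1), binomialWeight p n j = 1 := by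
  simpa [Polynomial.eval_finsetSum, eval_bernsteinPolynomial_eq_binomialWeight] using
    congrArg (Polynomial.eval p) (bernsteinPolynomial.sum ℝ n)

theorem sum_binomialWeight_mul_sub (p : ℝ) (n : ℕ) :
    ∑ j ∈ Finset.range (n + 1), binomialWeight p n j * (j - n * p) = 0 := by
  have h : ∑ j ∈ Finset.range (n + 1), (j : ℝ) * binomialWeight p n j = n * p := by
    simpa [Polynomial.eval_finsetSum, eval_bernsteinPolynomial_eq_binomialWeight] using
      congrArg (Polynomial.eval p) (bernsteinPolynomial.sum_smul ℝ n)
  simp only [mul_sub, Finset.sum_sub_distrib, ← Finset.sum_mul, sum_binomialWeight]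
  simp only [mul_comm (binomialWeight p n _), h]
  ring

theorem sum_binomialWeight_mul_sub_sq (p : ℝ) (n : ℕ) :
    ∑ j ∈ Finset.range (n + 1), binomialWeight p n j * (j - n * p) ^ 2 = n * p * (1 - p) := by
  have h : ∑ j ∈ Finset.range (n + 1), (n * p - j) ^ 2 * binomialWeight p n j
      = n * p * (1 - p) := by
    simpa [Polynomial.eval_finsetSum, eval_bernsteinPolynomial_eq_binomialWeight] using
      congrArg (Polynomial.eval p) (bernsteinPolynomial.variance ℝ n)
  rw [← h]
  exact Finset.sum_congr rfl fun j _ => by ring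

/-- Chernoff-type bound for the lower tail of the binomial distribution. -/
theorem sum_binomialWeight_mul_exp_le {p : ℝ} (hp0 : 0 ≤ p) (hp1 : p ≤ 1) (n : ℕ) :
    ∑ j ∈ Finset.range (n + 1), binomialWeight p n j * Real.exp (n * p / 2 - j)
      ≤ Real.exp (-(p * (1 / 2 - Real.exp (-1))) * n) := by
  have h : ∑ j ∈ Finset.range (n + 1), binomialWeight p n j * Real.exp (n * p / 2 - j)
      = Real.exp (n * p / 2) * (p * Real.exp (-1) + (1 - p)) ^ n := by
    rw [add_pow, Finset.mul_sum]
    refine Finset.sum_congr rfl fun j _ => ?_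
    have : Real.exp (-1) ^ j = Real.exp (-j) := by
      rw [← Real.exp_nat_mul]; ring_nf
    rw [mul_pow, this, sub_eq_add_neg, Real.exp_add, binomialWeight]
    ring
  have hbase : p * Real.exp (-1) + (1 - p) ≤ Real.exp (p * Real.exp (-1) - p) := by
    linarith [Real.add_one_le_exp (p * Real.exp (-1) - p)]
  have h0 : 0 ≤ p * Real.exp (-1) + (1 - p) :=
    add_nonneg (by positivity) (by linarith)
  calc _ = Real.exp (n * p / 2) * (p * Real.exp (-1) + (1 - p)) ^ n := h
    _ ≤ Real.exp (n * p / 2) * Real.exp (p * Real.exp (-1) - p) ^ n := by gcongr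
    _ = _ := by rw [← Real.exp_nat_mul, ← Real.exp_add]; ring_nf

/-- The deviation of the binomial expectation of `(max j 1) ^ (-s)` from `(n p) ^ (-s)`. -/
theorem abs_sum_binomialWeight_mul_sub_le {p s : ℝ} (hp0 : 0 ≤ p) (hp1 : p ≤ 1) (hs : 0 ≤ s)
    {n : ℕ} (hn : 2 ≤ n * p) :
    |∑ j ∈ Finset.range (n + 1), binomialWeight p n j * (max (j : ℝ) 1) ^ (-s)
        - (n * p) ^ (-s)| ≤
      s * (s + 1) * 2 ^ (s + 2) * (n * p) ^ (-s - 1)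
        + (1 + s) * Real.exp (-(p * (1 / 2 - Real.exp (-1))) * n) := by
  set x : ℝ := n * p with hx
  have hx0 : 0 < x := by linarith
  have e : ∑ j ∈ Finset.range (n + 1), binomialWeight p n j * (max (j : ℝ) 1) ^ (-s) - x ^ (-s)
      = ∑ j ∈ Finset.range (n + 1), binomialWeight p n j *
          ((max (j : ℝ) 1) ^ (-s) - x ^ (-s) + s * x ^ (-s - 1) * (j - x)) := by
    have h1 := congrArg (· * x ^ (-s)) (sum_binomialWeight p n)
    have h2 := congrArg (· * (s * x ^ (-s - 1))) (sum_binomialWeight_mul_sub p n)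
    simp only [Finset.sum_mul, ← hx] at h1 h2
    rw [show (∑ j ∈ Finset.range (n + 1), binomialWeight p n j *
          ((max (j : ℝ) 1) ^ (-s) - x ^ (-s) + s * x ^ (-s - 1) * (j - x)))
        = ∑ j ∈ Finset.range (n + 1), (binomialWeight p n j * (max (j : ℝ) 1) ^ (-s)
          - binomialWeight p n j * x ^ (-s)
          + binomialWeight p n j * (j - x) * (s * x ^ (-s - 1))) from
        Finset.sum_congr rfl fun j _ => by ring,
      Finset.sum_add_distrib, Finset.sum_sub_distrib, h1, h2]
    ring
  have hpow : x ^ (-s - 1) = x ^ (-s - 2) * x := by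
    rw [← Real.rpow_add_one hx0.ne']; ring_nf
  rw [e]
  calc _ ≤ ∑ j ∈ Finset.range (n + 1), binomialWeight p n j *
          (s * (s + 1) * 2 ^ (s + 2) * x ^ (-s - 2) * (j - x) ^ 2
            + (1 + s) * Real.exp (x / 2 - j)) := by
        refine (Finset.abs_sum_le_sum_abs _ _).trans (Finset.sum_le_sum fun j _ => ?_)
        rw [abs_mul, abs_of_nonneg (binomialWeight_nonneg hp0 hp1 n j)]
        exact mul_le_mul_of_nonneg_left (abs_max_rpow_neg_taylor_le hs hn j.cast_nonneg)
          (binomialWeight_nonneg hp0 hp1 n j)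
    _ = s * (s + 1) * 2 ^ (s + 2) * x ^ (-s - 2)
            * ∑ j ∈ Finset.range (n + 1), binomialWeight p n j * (j - x) ^ 2
          + (1 + s) * ∑ j ∈ Finset.range (n + 1), binomialWeight p n j * Real.exp (x / 2 - j) := by
        rw [Finset.mul_sum, Finset.mul_sum, ← Finset.sum_add_distrib]
        exact Finset.sum_congr rfl fun j _ => by ring
    _ ≤ _ := by
        rw [hpow, ← mul_assoc, sum_binomialWeight_mul_sub_sq]
        have hvar : x * (1 - p) ≤ x := mul_le_of_le_one_right hx0.le (by linarith)
        have := sum_binomialWeight_mul_exp_le hp0 hp1 n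
        gcongr

/-- For `0 < p ≤ 1` and `γ > 0`, as `n → ∞`,
`(1−p)^n + ∑_{j=1}^n j^{−γ} C(n,j) p^j (1−p)^{n−j} = (np)^{−γ} + O(n^{−γ−1})`, i.e. there
are `K`, `N` such that for all `n ≥ N` the left-hand side differs from `(np)^{−γ}` by at
most `K n^{−γ−1}`. -/
theorem stmt13 (p γ : ℝ) (hp0 : 0 < p) (hp1 : p ≤ 1) (hγ : 0 < γ) :
    ∃ (K : ℝ) (N : ℕ), ∀ n : ℕ, N ≤ n →
      |(1 - p) ^ n
          + (∑ j ∈ Finset.Icc 1 n, (j : ℝ) ^ (-γ) * (n.choose j) * p ^ j * (1 - p) ^ (n - j))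
          - ((n : ℝ) * p) ^ (-γ)|
        ≤ K * (n : ℝ) ^ (-γ - 1) := by
  have hc : 0 < p * (1 / 2 - Real.exp (-1)) := by
    have : Real.exp (-1) < 1 / 2 := by
      rw [Real.exp_neg, ← one_div]
      exact one_div_lt_one_div_of_lt two_pos (by linarith [Real.exp_one_gt_d9])
    exact mul_pos hp0 (by linarith)
  have hdecay := ((isLittleO_exp_neg_mul_rpow_atTop hc (-γ - 1)).bound one_pos)
  have hev := (tendsto_natCast_atTop_atTop (R := ℝ)).eventually
    (hdecay.and (eventually_ge_atTop (2 / p)))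
  obtain ⟨N, hN⟩ := eventually_atTop.1 hev
  refine ⟨γ * (γ + 1) * 2 ^ (γ + 2) * p ^ (-γ - 1) + (1 + γ), N, fun n hn => ?_⟩
  obtain ⟨h1, h2⟩ := hN n hn
  have hexp : Real.exp (-(p * (1 / 2 - Real.exp (-1))) * n) ≤ (n : ℝ) ^ (-γ - 1) := by
    rwa [one_mul, Real.norm_of_nonneg (Real.exp_pos _).le,
      Real.norm_of_nonneg (by positivity)] at h1
  have hsum : (1 - p) ^ n
      + (∑ j ∈ Finset.Icc 1 n, (j : ℝ) ^ (-γ) * (n.choose j) * p ^ j * (1 - p) ^ (n - j))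
      = ∑ j ∈ Finset.range (n + 1), binomialWeight p n j * (max (j : ℝ) 1) ^ (-γ) := by
    rw [Finset.range_eq_Ico, Finset.sum_eq_sum_Ico_succ_bot n.succ_pos]
    congr 1
    · simp [binomialWeight]
    · refine Finset.sum_congr rfl fun j hj => ?_
      have hj1 : (1 : ℝ) ≤ j := by exact_mod_cast (Finset.mem_Icc.1 hj).1
      rw [max_eq_left hj1, binomialWeight]
      ring
  rw [hsum]
  refine (abs_sum_binomialWeight_mul_sub_le hp0.le hp1 hγ.le ((div_le_iff₀ hp0).1 h2)).trans ?_
  rw [Real.mul_rpow n.cast_nonneg hp0.le]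
  linear_combination (1 + γ) * hexp
end

section
/- Let μ be a probability measure on [0,∞), let a > 0 be a point in the support of μ with μ([0,a)) > 0, and set p = μ([a,∞)); assume p > 0. Let ε : [0,∞) → [0,∞) be nonincreasing with ε(r) ≤ C(1 ∧ r^{−γ}) for all r ≥ 0, where C ≥ 0 and γ > 0. Then ∫_{[0,∞)} ε(r) μ^{*n}(dr) ≤ C(nap)^{−γ} + O(n^{−γ−1}) as n → ∞; i.e. there exist K and N such that for all n ≥ N, ∫_{[0,∞)} ε(r) μ^{*n}(dr) ≤ C(nap)^{−γ} + K n^{−γ−1}. -/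
open MeasureTheory Filter Topology ENNReal

/-- `convPow μ n` is the `n`-fold convolution `μ^{*n}` of the measure `μ` on `ℝ`;
`μ^{*0}` is the Dirac measure at `0`. -/
noncomputable def convPow (μ : Measure ℝ) : ℕ → Measure ℝ
  | 0 => Measure.dirac 0
  | n + 1 => Measure.map (fun p : ℝ × ℝ => p.1 + p.2) ((convPow μ n).prod μ)

/-- The convolution powers of an s-finite measure are s-finite. -/
theorem sFinite_convPow (μ : Measure ℝ) [SFinite μ] (n : ℕ) : SFinite (convPow μ n) := by
  induction n with
  | zero => rw [convPow]; infer_instance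
  | succ n ih => rw [convPow]; infer_instance

/-- Integrating a nonnegative antitone function against a measure on `[0,∞)` increases when the
measure is replaced by the two-point measure with mass `p = μ [a,∞)` at `a`
and mass `1 - p` at `0`. -/
theorem lintegral_translate_le_two_point (μ : Measure ℝ) [IsProbabilityMeasure μ]
    (hsupp : μ (Set.Iio 0) = 0) (a : ℝ) {h : ℝ → ℝ} (h_nonneg : ∀ r, 0 ≤ h r)
    (h_anti : Antitone h) (x : ℝ) :
    ∫⁻ y, ENNReal.ofReal (h (x + y)) ∂μ ≤
      ENNReal.ofReal (μ.real (Set.Ici a) * h (x + a) + (1 - μ.real (Set.Ici a)) * h x) := by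
  have hae : ∀ᵐ y ∂μ, 0 ≤ y := by
    rw [ae_iff]
    simp only [not_le]
    exact hsupp
  have hle : μ.real (Set.Ici a) ≤ 1 := measureReal_le_one
  rw [← lintegral_add_compl _ (measurableSet_Ici (a := a)),
    ENNReal.ofReal_add (mul_nonneg measureReal_nonneg (h_nonneg _))
      (mul_nonneg (sub_nonneg.2 hle) (h_nonneg _)),
    ENNReal.ofReal_mul measureReal_nonneg, ENNReal.ofReal_mul (sub_nonneg.2 hle),
    ← probReal_compl_eq_one_sub measurableSet_Ici, ofReal_measureReal, ofReal_measureReal]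
  gcongr
  · calc ∫⁻ y in Set.Ici a, ENNReal.ofReal (h (x + y)) ∂μ
        ≤ ∫⁻ _ in Set.Ici a, ENNReal.ofReal (h (x + a)) ∂μ :=
          setLIntegral_mono measurable_const fun y hy =>
            ENNReal.ofReal_le_ofReal (h_anti (by gcongr; exact hy))
      _ = _ := by rw [setLIntegral_const, mul_comm]
  · calc ∫⁻ y in (Set.Ici a)ᶜ, ENNReal.ofReal (h (x + y)) ∂μ
        ≤ ∫⁻ _ in (Set.Ici a)ᶜ, ENNReal.ofReal (h x) ∂μ :=
          lintegral_mono_ae ((ae_restrict_of_ae hae).mono fun y hy =>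
            ENNReal.ofReal_le_ofReal (h_anti (by linarith)))
      _ = _ := by rw [setLIntegral_const, mul_comm]

/-- If `F` solves the recursion of the binomial random walk with success probability
`p = μ [a,∞)` and majorizes the antitone function `h` along the multiples of `a` at time `k`, then
the integral of `h` against `μ^{*n}` is at most the value of `F` at time `k + n`. -/
theorem lintegral_convPow_le_of_majorant (μ : Measure ℝ) [IsProbabilityMeasure μ]
    (hsupp : μ (Set.Iio 0) = 0) (a : ℝ) (F : ℕ → ℕ → ℝ)
    (hF : ∀ k j, F (k + 1) j =
      μ.real (Set.Ici a) * F k (j + 1) + (1 - μ.real (Set.Ici a)) * F k j)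
    (n k : ℕ) {h : ℝ → ℝ} (h_nonneg : ∀ r, 0 ≤ h r) (h_anti : Antitone h)
    (hle : ∀ j : ℕ, h (a * j) ≤ F k j) :
    ∫⁻ r, ENNReal.ofReal (h r) ∂(convPow μ n) ≤ ENNReal.ofReal (F (k + n) 0) := by
  have hp0 : 0 ≤ μ.real (Set.Ici a) := measureReal_nonneg
  have hp1 : 0 ≤ 1 - μ.real (Set.Ici a) := sub_nonneg.2 measureReal_le_one
  induction n generalizing k h with
  | zero =>
    have hm : Measurable fun r => ENNReal.ofReal (h r) := h_anti.measurable.ennreal_ofReal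
    rw [convPow, lintegral_dirac' _ hm]
    exact ENNReal.ofReal_le_ofReal (by simpa using hle 0)
  | succ n ih =>
    have := sFinite_convPow μ n
    have hm : Measurable fun r => ENNReal.ofReal (h r) := h_anti.measurable.ennreal_ofReal
    have hadd : Measurable fun z : ℝ × ℝ => ENNReal.ofReal (h (z.1 + z.2)) :=
      hm.comp (measurable_fst.add measurable_snd)
    rw [convPow, lintegral_map hm (by fun_prop), lintegral_prod _ hadd.aemeasurable]
    refine (lintegral_mono fun x =>
      lintegral_translate_le_two_point μ hsupp a h_nonneg h_anti x).trans ?_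
    rw [← add_assoc, add_right_comm]
    refine ih (k + 1) (h := fun x => μ.real (Set.Ici a) * h (x + a) +
      (1 - μ.real (Set.Ici a)) * h x) (fun r => ?_) (fun r s hrs => ?_) fun j => ?_
    · exact add_nonneg (mul_nonneg hp0 (h_nonneg _)) (mul_nonneg hp1 (h_nonneg _))
    · have h1 := h_anti (add_le_add_left hrs a)
      have h2 := h_anti hrs
      dsimp only
      gcongr
    · have h1 := hle (j + 1)
      have h2 := hle j
      rw [hF]
      push_cast [mul_add, mul_one] at h1
      gcongr

/-- A quadratic upper bound for `x ↦ x ^ (-γ)` around `1`, valid on `[1/2, ∞)`. -/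
theorem rpow_neg_le_quadratic {γ x : ℝ} (hγ : 0 ≤ γ) (hx : 1 / 2 ≤ x) :
    x ^ (-γ) ≤ 1 - γ * (x - 1) + (2 * γ + 4 * γ ^ 2 * Real.exp γ) * (x - 1) ^ 2 := by
  have hx0 : 0 < x := by linarith
  have hinv2 : x⁻¹ ≤ 2 := by
    rw [inv_le_comm₀ hx0 two_pos]; linarith
  have hinv0 : 0 < x⁻¹ := inv_pos.2 hx0
  set s := γ * (x⁻¹ - 1) with hs
  have h_abs : |s| ≤ γ := by
    rw [hs, abs_mul, abs_of_nonneg hγ]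
    exact mul_le_of_le_one_right hγ (abs_le.2 ⟨by linarith, by linarith⟩)
  have h_pow : x ^ (-γ) ≤ Real.exp s := by
    rw [Real.rpow_def_of_pos hx0, Real.exp_le_exp, hs]
    have := Real.one_sub_inv_le_log_of_pos hx0
    nlinarith
  have h_exp : Real.exp s ≤ 1 + s + s ^ 2 * Real.exp γ := by
    have h1 : |Real.exp s - (1 + s)| ≤ |s| ^ 2 * Real.exp |s| := by
      have := Complex.norm_exp_sub_sum_le_norm_mul_exp (s : ℂ) 2
      simp only [Finset.sum_range_succ, Finset.sum_range_zero] at this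
      simp only [Complex.norm_real, Real.norm_eq_abs] at this
      rw [← Real.norm_eq_abs, ← Complex.norm_real]
      simpa using this
    have h2 : |s| ^ 2 * Real.exp |s| ≤ s ^ 2 * Real.exp γ := by
      rw [sq_abs]; gcongr
    linarith [le_abs_self (Real.exp s - (1 + s))]
  have h_lin : s ≤ -(γ * (x - 1)) + 2 * γ * (x - 1) ^ 2 := by
    have h1 : s = -(γ * (x - 1)) + γ * (x - 1) ^ 2 * x⁻¹ := by
      rw [hs]; field_simp; ring
    have h2 : γ * (x - 1) ^ 2 * x⁻¹ ≤ γ * (x - 1) ^ 2 * 2 := by gcongr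
    linarith
  have h_sq : s ^ 2 ≤ 4 * γ ^ 2 * (x - 1) ^ 2 := by
    have h1 : s ^ 2 = γ ^ 2 * (x - 1) ^ 2 * x⁻¹ ^ 2 := by
      rw [hs]; field_simp; ring
    have h2 : γ ^ 2 * (x - 1) ^ 2 * x⁻¹ ^ 2 ≤ γ ^ 2 * (x - 1) ^ 2 * 2 ^ 2 := by gcongr
    linarith
  have h_sq' := mul_le_mul_of_nonneg_right h_sq (Real.exp_pos γ).le
  linarith

/-- The lower-tail factor of the binomial law, `2 ^ (n p / 2) (1 - p / 2) ^ n`, is eventually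
smaller than any power of `n`. -/
theorem eventually_two_rpow_mul_pow_le (p s : ℝ) (hp0 : 0 < p) (hp1 : p ≤ 1) :
    ∀ᶠ n : ℕ in atTop, (2 : ℝ) ^ (n * p / 2) * (1 - p / 2) ^ n ≤ (n : ℝ) ^ (-s) := by
  have hlog : Real.log 2 < 1 := by linarith [Real.log_two_lt_d9]
  have hb : 0 < p * (1 - Real.log 2) / 2 := by
    have : 0 < 1 - Real.log 2 := by linarith
    positivity
  have ht := (tendsto_rpow_mul_exp_neg_mul_atTop_nhds_zero s _ hb).comp
    (tendsto_natCast_atTop_atTop (R := ℝ))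
  filter_upwards [ht.eventually_le_const one_pos, eventually_gt_atTop 0] with n hn hn0
  have hn0' : (0 : ℝ) < n := by exact_mod_cast hn0
  have h1 : (1 - p / 2) ^ n ≤ Real.exp (-(p / 2)) ^ n :=
    pow_le_pow_left₀ (by linarith) (Real.one_sub_le_exp_neg _) n
  calc (2 : ℝ) ^ (n * p / 2) * (1 - p / 2) ^ n
      ≤ (2 : ℝ) ^ (n * p / 2) * Real.exp (-(p / 2)) ^ n := by gcongr
    _ = Real.exp (-(p * (1 - Real.log 2) / 2) * n) := by
      rw [Real.rpow_def_of_pos two_pos, ← Real.exp_nat_mul, ← Real.exp_add]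
      congr 1; ring
    _ ≤ (n : ℝ) ^ (-s) := by
      rw [Real.rpow_neg hn0'.le, ← one_div, le_div_iff₀' (by positivity)]
      exact hn

/-- Let `μ` be a probability measure on `[0,∞)`, let `a > 0` be a point
in the support of `μ` with `μ([0,a)) > 0`, and let `p = μ([a,∞)) > 0`. If `ε` is
nonincreasing with `ε(r) ≤ C (1 ∧ r^{−γ})` (so `ε ≤ C` everywhere and `ε(r) ≤ C r^{−γ}`
for `r > 0`), then `∫_{[0,∞)} ε(r) μ^{*n}(dr) ≤ C (nap)^{−γ} + O(n^{−γ−1})` as `n → ∞`. -/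
theorem stmt16 (μ : Measure ℝ) [IsProbabilityMeasure μ] (hsupp : μ (Set.Iio 0) = 0)
    (a : ℝ) (ha : 0 < a)
    -- `a` lies in the (topological) support of `μ`:
    (hasupp : ∀ δ : ℝ, 0 < δ → 0 < μ (Set.Ioo (a - δ) (a + δ)))
    (hμ0a : 0 < μ (Set.Ico 0 a))
    (p : ℝ) (hp : p = (μ (Set.Ici a)).toReal) (hppos : 0 < p)
    (ε : ℝ → ℝ) (C γ : ℝ) (hC : 0 ≤ C) (hγ : 0 < γ)
    (hεnonneg : ∀ r : ℝ, 0 ≤ r → 0 ≤ ε r) (hεanti : AntitoneOn ε (Set.Ici 0))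
    (hεbdd : ∀ r : ℝ, 0 ≤ r → ε r ≤ C)
    (hε : ∀ r : ℝ, 0 < r → ε r ≤ C * r ^ (-γ)) :
    ∃ (K : ℝ) (N : ℕ), ∀ n : ℕ, N ≤ n →
      (∫⁻ r in Set.Ici (0 : ℝ), ENNReal.ofReal (ε r) ∂(convPow μ n))
        ≤ ENNReal.ofReal (C * ((n : ℝ) * a * p) ^ (-γ) + K * (n : ℝ) ^ (-γ - 1)) := by
  have hpr : μ.real (Set.Ici a) = p := hp.symm
  have hp1 : p ≤ 1 := hpr ▸ measureReal_le_one
  set D := 2 * γ + 4 * γ ^ 2 * Real.exp γ with hD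
  have hD0 : 0 ≤ D := by positivity
  obtain ⟨N, hN⟩ := eventually_atTop.1 (eventually_two_rpow_mul_pow_le p (γ + 1) hppos hp1)
  refine ⟨C * ((a * p) ^ (-γ) * (D * (1 - p) / p) + 1), N + 1, fun n hn => ?_⟩
  have hn0 : (0 : ℝ) < n := by exact_mod_cast (by lia : 0 < n)
  set m : ℝ := n * p with hm
  have hm0 : 0 < m := by positivity
  set L := C * (a * m) ^ (-γ) with hL
  have hL0 : 0 ≤ L := by positivity
  let F : ℕ → ℕ → ℝ := fun k j =>
    L * (1 - γ * ((j - m + k * p) / m) +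
      D * (((j - m + k * p) ^ 2 + k * p * (1 - p)) / m ^ 2)) +
    C * ((2 : ℝ) ^ (m / 2) * (1 - p / 2) ^ k * (1 / 2) ^ j)
  have hF : ∀ k j, F (k + 1) j =
      μ.real (Set.Ici a) * F k (j + 1) + (1 - μ.real (Set.Ici a)) * F k j := by
    intro k j
    simp only [hpr, F]
    push_cast
    ring
  let h : ℝ → ℝ := fun r => ε (max r 0)
  have h_nonneg : ∀ r, 0 ≤ h r := fun r => hεnonneg _ (le_max_right _ _)
  have h_anti : Antitone h := fun r s hrs =>
    hεanti (Set.mem_Ici.2 (le_max_right _ _)) (Set.mem_Ici.2 (le_max_right _ _))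
      (max_le_max_right 0 hrs)
  have h_le : ∀ j : ℕ, h (a * j) ≤ F 0 j := by
    intro j
    have hF0 : F 0 j = L * (1 - γ * (j / m - 1) + D * (j / m - 1) ^ 2) +
        C * ((2 : ℝ) ^ (m / 2) * (1 / 2) ^ j) := by
      simp only [F, Nat.cast_zero, zero_mul, add_zero, pow_zero, mul_one]
      rw [← div_pow, sub_div, div_self hm0.ne']
    have hj0 : (0 : ℝ) ≤ a * j := by positivity
    simp only [h, max_eq_left hj0]
    rw [hF0]
    rcases le_or_gt (1 / 2) ((j : ℝ) / m) with hj | hj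
    · have hjpos : (0 : ℝ) < j := by
        by_contra! hneg
        have := div_nonpos_of_nonpos_of_nonneg hneg hm0.le
        linarith
      have hsplit : (a * j) ^ (-γ) = (a * m) ^ (-γ) * ((j : ℝ) / m) ^ (-γ) := by
        rw [← Real.mul_rpow (by positivity) (by positivity)]
        congr 1
        field_simp
      calc ε (a * j) ≤ C * (a * j) ^ (-γ) := hε _ (by positivity)
        _ = L * ((j : ℝ) / m) ^ (-γ) := by rw [hsplit, hL, mul_assoc]
        _ ≤ L * (1 - γ * (j / m - 1) + D * (j / m - 1) ^ 2) := by
          gcongr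
          exact rpow_neg_le_quadratic hγ.le hj
        _ ≤ _ := le_add_of_nonneg_right (by positivity)
    · have h1 : 0 ≤ 1 - γ * (j / m - 1) + D * (j / m - 1) ^ 2 := by
        have : γ * (j / m - 1) ≤ 0 :=
          mul_nonpos_of_nonneg_of_nonpos hγ.le (by linarith)
        have : 0 ≤ D * (j / m - 1) ^ 2 := by positivity
        linarith
      have h2 : 1 ≤ (2 : ℝ) ^ (m / 2) * (1 / 2) ^ j := by
        rw [one_div, inv_pow, ← Real.rpow_natCast, ← Real.rpow_neg two_pos.le,
          ← Real.rpow_add two_pos]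
        refine Real.one_le_rpow one_le_two ?_
        rw [div_lt_iff₀ hm0] at hj
        linarith
      calc ε (a * j) ≤ C * 1 := by simpa using hεbdd _ hj0
        _ ≤ C * ((2 : ℝ) ^ (m / 2) * (1 / 2) ^ j) := by gcongr
        _ ≤ _ := le_add_of_nonneg_left (mul_nonneg hL0 h1)
  have h_restrict : ∫⁻ r in Set.Ici (0 : ℝ), ENNReal.ofReal (ε r) ∂(convPow μ n) ≤
      ∫⁻ r, ENNReal.ofReal (h r) ∂(convPow μ n) := by
    refine le_trans (le_of_eq (setLIntegral_congr_fun measurableSet_Ici fun r hr => ?_))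
      (setLIntegral_le_lintegral (Set.Ici 0) _)
    simp only [h, max_eq_left (Set.mem_Ici.1 hr)]
  refine h_restrict.trans ((lintegral_convPow_le_of_majorant μ hsupp a F hF n 0 h_nonneg h_anti
    h_le).trans (ENNReal.ofReal_le_ofReal ?_))
  have hFn : F (0 + n) 0 = L + L * (D * (1 - p) / p) * (n : ℝ)⁻¹ +
      C * ((2 : ℝ) ^ (m / 2) * (1 - p / 2) ^ n) := by
    simp only [F, zero_add, Nat.cast_zero, pow_zero, mul_one]
    rw [hm]
    field_simp
    ring
  have hLn : L * (n : ℝ)⁻¹ = C * (a * p) ^ (-γ) * (n : ℝ) ^ (-γ - 1) := by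
    rw [hL, hm, Real.rpow_sub_one hn0.ne', show a * (n * p) = (a * p) * n by ring,
      Real.mul_rpow (by positivity) hn0.le]
    ring
  have h_tail : C * ((2 : ℝ) ^ (m / 2) * (1 - p / 2) ^ n) ≤ C * (n : ℝ) ^ (-γ - 1) := by
    have := hN n (by lia)
    rw [neg_add'] at this
    gcongr
  calc F (0 + n) 0 = L + L * (n : ℝ)⁻¹ * (D * (1 - p) / p) +
        C * ((2 : ℝ) ^ (m / 2) * (1 - p / 2) ^ n) := by rw [hFn]; ring
    _ ≤ L + C * (a * p) ^ (-γ) * (n : ℝ) ^ (-γ - 1) * (D * (1 - p) / p) +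
        C * (n : ℝ) ^ (-γ - 1) := by rw [hLn]; gcongr
    _ = _ := by
      rw [hL, hm, show a * (n * p) = n * a * p by ring]
      ring
end
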